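/- arXiv:1912.03853 — 2 statements merged into one kernel-verified Lean document; each statement's English description precedes it below -/
import Mathlib

section
/- Let X and Y be independent real random variables on a probability space, where X is exponentially distributed with mean Ω₁ > 0 and Y is exponentially distributed with mean Ω₂ > 0, and let c > 0 and k > 0. Then P(X ≤ c and Y ≤ kX) = (1 − exp(−c/Ω₁)) − (Ω₂/(Ω₂ + kΩ₁)) · (1 − exp(−c·(1/Ω₁ + k/Ω₂))). -/
open MeasureTheory ProbabilityTheory in
/-- A nonnegative random variable with exponential tail of mean `m` has law `expMeasure m⁻¹`. -/
theorem map_eq_expMeasure_of_tail {α : Type*} [MeasurableSpace α]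
    {μ : Measure α} [IsProbabilityMeasure μ] {X : α → ℝ} (hX : Measurable X)
    {m : ℝ} (hm : 0 < m) (hXnn : ∀ᵐ ω ∂μ, 0 ≤ X ω)
    (hXexp : ∀ t : ℝ, 0 ≤ t → μ {ω | t < X ω} = ENNReal.ofReal (Real.exp (-t / m))) :
    μ.map X = expMeasure m⁻¹ := by
  have := Measure.isProbabilityMeasure_map (μ := μ) hX.aemeasurable
  have := isProbabilityMeasure_expMeasure (inv_pos.2 hm)
  refine Measure.eq_of_cdf _ _ ?_
  ext x
  rw [cdf_expMeasure_eq (inv_pos.2 hm), cdf_eq_real, map_measureReal_apply hX measurableSet_Iic]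
  split_ifs with hx
  · have hcompl : X ⁻¹' Set.Iic x = {ω | x < X ω}ᶜ := by
      ext ω
      simp
    rw [hcompl, probReal_compl_eq_one_sub (measurableSet_lt measurable_const hX), measureReal_def,
      hXexp x hx, ENNReal.toReal_ofReal (Real.exp_pos _).le]
    congr 2
    ring
  · rw [measureReal_def, show μ (X ⁻¹' Set.Iic x) = 0 from ?_, ENNReal.toReal_zero]
    refine measure_mono_null (fun ω hω => ?_) (ae_iff.1 hXnn)
    simp only [Set.mem_preimage, Set.mem_Iic, Set.mem_ofPred_eq] at hω ⊢
    linarith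

theorem integral_exp_density_mul_one_sub_exp {r q : ℝ} (hq : r + q ≠ 0) (c : ℝ) :
    ∫ x in (0 : ℝ)..c, r * Real.exp (-(r * x)) * (1 - Real.exp (-(q * x)))
      = (1 - Real.exp (-(r * c))) - r / (r + q) * (1 - Real.exp (-((r + q) * c))) := by
  have hderiv : ∀ x ∈ Set.uIcc 0 c, HasDerivAt
      (fun x => -Real.exp (-(r * x)) + r / (r + q) * Real.exp (-((r + q) * x)))
      (r * Real.exp (-(r * x)) * (1 - Real.exp (-(q * x)))) x := by
    intro x _
    have hexp : ∀ a : ℝ, HasDerivAt (fun x => Real.exp (-(a * x)))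
        (Real.exp (-(a * x)) * -(a * 1)) x :=
      fun a => ((hasDerivAt_id x).const_mul a).neg.exp
    refine ((hexp r).neg.add ((hexp (r + q)).const_mul (r / (r + q)))).congr_deriv ?_
    rw [show -((r + q) * x) = -(r * x) + -(q * x) by ring, Real.exp_add]
    field_simp
    ring
  rw [intervalIntegral.integral_eq_sub_of_hasDerivAt hderiv
    (Continuous.intervalIntegrable (by fun_prop) _ _)]
  simp
  ring

open MeasureTheory ProbabilityTheory in
theorem expMeasure_Iic {r : ℝ} (hr : 0 < r) {x : ℝ} (hx : 0 ≤ x) :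
    expMeasure r (Set.Iic x) = ENNReal.ofReal (1 - Real.exp (-(r * x))) := by
  have := isProbabilityMeasure_expMeasure hr
  rw [← ofReal_cdf, cdf_expMeasure_eq hr, if_pos hx]

open MeasureTheory ProbabilityTheory in
theorem expMeasure_prod_apply_le_and_le_mul {r s : ℝ} (hr : 0 < r) (hs : 0 < s)
    {c k : ℝ} (hc : 0 ≤ c) (hk : 0 ≤ k) :
    (expMeasure r).prod (expMeasure s) {p : ℝ × ℝ | p.1 ≤ c ∧ p.2 ≤ k * p.1}
      = ENNReal.ofReal ((1 - Real.exp (-(r * c)))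
          - r / (r + s * k) * (1 - Real.exp (-((r + s * k) * c)))) := by
  have := isProbabilityMeasure_expMeasure hr
  have := isProbabilityMeasure_expMeasure hs
  have hS : MeasurableSet {p : ℝ × ℝ | p.1 ≤ c ∧ p.2 ≤ k * p.1} :=
    (measurableSet_le measurable_fst measurable_const).inter
      (measurableSet_le measurable_snd (measurable_fst.const_mul k))
  have hpdf : Measurable (exponentialPDF r) := (measurable_exponentialPDFReal r).ennreal_ofReal
  have hdens : expMeasure r = volume.withDensity (exponentialPDF r) := rfl
  have hq : r + s * k ≠ 0 := by positivity
  rw [Measure.prod_apply hS, hdens,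
    lintegral_withDensity_eq_lintegral_mul _ hpdf (measurable_measure_prodMk_left hS),
    ← integral_exp_density_mul_one_sub_exp hq, intervalIntegral.integral_of_le hc,
    ← integral_Icc_eq_integral_Ioc, ofReal_integral_eq_lintegral_ofReal,
    ← lintegral_indicator measurableSet_Icc]
  · refine lintegral_congr fun x => ?_
    rw [Pi.mul_apply, Set.indicator_apply]
    split_ifs with hx
    · have hsec : Prod.mk x ⁻¹' {p : ℝ × ℝ | p.1 ≤ c ∧ p.2 ≤ k * p.1} = Set.Iic (k * x) := by
        ext y
        simp [hx.2]
      rw [hsec, expMeasure_Iic hs (mul_nonneg hk hx.1), exponentialPDF_of_nonneg hx.1,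
        ← ENNReal.ofReal_mul (by positivity), mul_assoc s k x]
    · rcases lt_or_ge x 0 with h0 | h0
      · rw [exponentialPDF_of_neg h0, zero_mul]
      · have hxc : ¬ x ≤ c := fun h => hx ⟨h0, h⟩
        simp [hxc]
  · exact Continuous.integrableOn_Icc (by fun_prop)
  · filter_upwards [ae_restrict_mem measurableSet_Icc] with x hx
    have hle : Real.exp (-(s * k * x)) ≤ 1 :=
      Real.exp_le_one_iff.2 (neg_nonpos.2 (mul_nonneg (by positivity) hx.1))
    exact mul_nonneg (by positivity) (sub_nonneg.2 hle)


open MeasureTheory ProbabilityTheory in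
theorem exp_joint_prob_T3 {α : Type*} [MeasurableSpace α]
    (μ : Measure α) [IsProbabilityMeasure μ]
    (X Y : α → ℝ) (hX : Measurable X) (hY : Measurable Y)
    (Ω₁ Ω₂ : ℝ) (hΩ₁ : 0 < Ω₁) (hΩ₂ : 0 < Ω₂)
    (hXnn : ∀ᵐ ω ∂μ, 0 ≤ X ω) (hYnn : ∀ᵐ ω ∂μ, 0 ≤ Y ω)
    (hXexp : ∀ t : ℝ, 0 ≤ t → μ {ω | t < X ω} = ENNReal.ofReal (Real.exp (-t / Ω₁)))
    (hYexp : ∀ t : ℝ, 0 ≤ t → μ {ω | t < Y ω} = ENNReal.ofReal (Real.exp (-t / Ω₂)))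
    (hindep : IndepFun X Y μ)
    (c k : ℝ) (hc : 0 < c) (hk : 0 < k) :
    μ {ω | X ω ≤ c ∧ Y ω ≤ k * X ω}
      = ENNReal.ofReal
          ((1 - Real.exp (-c / Ω₁)) -
            (Ω₂ / (Ω₂ + k * Ω₁)) * (1 - Real.exp (-c * (1 / Ω₁ + k / Ω₂)))) := by
  have hS : MeasurableSet {p : ℝ × ℝ | p.1 ≤ c ∧ p.2 ≤ k * p.1} :=
    (measurableSet_le measurable_fst measurable_const).inter
      (measurableSet_le measurable_snd (measurable_fst.const_mul k))
  have hlaw := (indepFun_iff_map_prod_eq_prod_map_map hX.aemeasurable hY.aemeasurable).1 hindep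
  rw [map_eq_expMeasure_of_tail hX hΩ₁ hXnn hXexp,
    map_eq_expMeasure_of_tail hY hΩ₂ hYnn hYexp] at hlaw
  have hprob := expMeasure_prod_apply_le_and_le_mul (inv_pos.2 hΩ₁) (inv_pos.2 hΩ₂) hc.le hk.le
  rw [← hlaw, Measure.map_apply (hX.prodMk hY) hS] at hprob
  refine hprob.trans ?_
  have hcoef : Ω₁⁻¹ / (Ω₁⁻¹ + Ω₂⁻¹ * k) = Ω₂ / (Ω₂ + k * Ω₁) := by
    field_simp
  rw [hcoef, show -(Ω₁⁻¹ * c) = -c / Ω₁ by ring,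
    show -((Ω₁⁻¹ + Ω₂⁻¹ * k) * c) = -c * (1 / Ω₁ + k / Ω₂) by ring]
end

section
/- System parameters: power allocation factors η₁, η₂, η₃ > 0 with η₁+η₂+η₃ = 1; average channel gains Ω_SR, Ω_RD > 0; for each total SNR γ_P > 0 set γ_S = η₁γ_P, γ_R = η₂γ_P, γ_D = η₃γ_P; g_SR and g_RD are independent exponentially distributed random variables with means Ω_SR and Ω_RD. Define the random variable Φ_LB(γ_P) = (1 + (γ_R/(γ_R + γ_D))·min(γ_S g_SR, (γ_R + γ_D) g_RD)) / (1 + γ_S g_SR/(γ_D g_RD + 1)). Then for every fixed φ > 1, lim_{γ_P → ∞} √γ_P · P(Φ_LB(γ_P) ≤ φ) = √(π·η₁·φ·Ω_SR/(4·η₂·η₃·Ω_RD²)). In particular, the secrecy outage probability decays as γ_P^{−1/2}, i.e., the system has diversity order 1/2. -/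
section Auxiliary

open MeasureTheory ProbabilityTheory Real Filter Set

section Exponential

theorem map_eq_expMeasure {α : Type*} [MeasurableSpace α] {μ : Measure α} [IsProbabilityMeasure μ]
    {X : α → ℝ} (hX : Measurable X) {Ω : ℝ} (hΩ : 0 < Ω) (hnn : ∀ᵐ ω ∂μ, 0 ≤ X ω)
    (hexp : ∀ t : ℝ, 0 ≤ t → μ {ω | t < X ω} = ENNReal.ofReal (Real.exp (-t / Ω))) :
    μ.map X = expMeasure (1 / Ω) := by
  have hr : 0 < 1 / Ω := by positivity
  have := isProbabilityMeasure_expMeasure hr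
  have := Measure.isProbabilityMeasure_map (μ := μ) hX.aemeasurable
  refine Measure.eq_of_cdf _ _ ?_
  ext x
  rw [cdf_expMeasure_eq hr, cdf_eq_real, map_measureReal_apply hX measurableSet_Iic]
  split_ifs with hx
  · have h : X ⁻¹' Iic x = {ω | x < X ω}ᶜ := by ext; simp
    rw [h, probReal_compl_eq_one_sub (measurableSet_lt measurable_const hX), measureReal_def,
      hexp x hx, ENNReal.toReal_ofReal (exp_pos _).le]
    congr 2
    ring
  · rw [measureReal_def, measure_eq_zero_iff_ae_notMem.2, ENNReal.toReal_zero]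
    filter_upwards [hnn] with ω hω
    simp only [mem_preimage, mem_Iic]
    linarith

theorem expMeasure_real_Iic {r : ℝ} (hr : 0 < r) (x : ℝ) :
    (expMeasure r).real (Iic x) = if 0 ≤ x then 1 - exp (-(r * x)) else 0 := by
  have := isProbabilityMeasure_expMeasure hr
  rw [← cdf_eq_real, cdf_expMeasure_eq hr]

theorem expMeasure_real_Iic_le {r : ℝ} (hr : 0 < r) {x : ℝ} (hx : 0 ≤ x) :
    (expMeasure r).real (Iic x) ≤ r * x := by
  rw [expMeasure_real_Iic hr, if_pos hx]
  linarith [add_one_le_exp (-(r * x))]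

theorem one_sub_exp_neg_ge {t : ℝ} (ht : 0 ≤ t) : t - t ^ 2 / 2 ≤ 1 - exp (-t) := by
  have h := quadratic_le_exp_of_nonneg ht
  have h1 : exp (-t) * exp t = 1 := by rw [← exp_add]; simp
  have h2 := exp_pos (-t)
  have h3 : exp (-t) * (1 + t + t ^ 2 / 2) ≤ 1 := by nlinarith
  have h4 : 1 ≤ (1 - t + t ^ 2 / 2) * (1 + t + t ^ 2 / 2) := by nlinarith [sq_nonneg (t ^ 2)]
  nlinarith [sq_nonneg t]

theorem le_expMeasure_real_Iic {r : ℝ} (hr : 0 < r) {x ε : ℝ} (hε : 0 ≤ ε) :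
    r * x - r * ε - r ^ 2 * x ^ 2 / 2 ≤ (expMeasure r).real (Iic (x - ε)) := by
  rw [expMeasure_real_Iic hr]
  split_ifs with h
  · have h1 := one_sub_exp_neg_ge (mul_nonneg hr.le h)
    have h2 : (r * (x - ε)) ^ 2 ≤ (r * x) ^ 2 :=
      pow_le_pow_left₀ (by positivity) (by gcongr; linarith) 2
    nlinarith
  · have : r * x ≤ r * ε := by gcongr; linarith
    have : 0 ≤ r ^ 2 * x ^ 2 / 2 := by positivity
    linarith

theorem toReal_gammaPDF_one_smul_rpow_ae_eq {r : ℝ} (hr : 0 < r) (p : ℝ) :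
    (fun x ↦ (gammaPDF 1 r x).toReal • x ^ p) =ᵐ[volume]
      (Ioi 0).indicator (fun x ↦ r * (x ^ p * exp (-(r * x)))) := by
  filter_upwards [Measure.ae_ne volume (0 : ℝ)] with x hx
  rcases lt_or_gt_of_ne hx with h | h
  · rw [gammaPDF_of_neg h, indicator_of_notMem (by simpa using h.le)]
    simp
  · rw [gammaPDF_of_nonneg h.le, indicator_of_mem (by simpa using h),
      ENNReal.toReal_ofReal (by positivity)]
    simp
    ring

theorem integral_rpow_expMeasure {r p : ℝ} (hr : 0 < r) (hp : -1 < p) :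
    ∫ x, x ^ p ∂(expMeasure r) = Gamma (p + 1) / r ^ p := by
  have h := integral_rpow_mul_exp_neg_mul_Ioi (a := p + 1) (by linarith) hr
  rw [add_sub_cancel_right] at h
  have hm : Measurable (gammaPDF 1 r) := (measurable_gammaPDFReal 1 r).ennreal_ofReal
  rw [expMeasure, gammaMeasure, integral_withDensity_eq_integral_toReal_smul hm (by simp [gammaPDF]),
    integral_congr_ae (toReal_gammaPDF_one_smul_rpow_ae_eq hr p), integral_indicator measurableSet_Ioi,
    integral_const_mul, h, one_div, inv_rpow hr.le, rpow_add_one hr.ne']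
  field_simp

theorem integrable_rpow_expMeasure {r p : ℝ} (hr : 0 < r) (hp : -1 < p) :
    Integrable (fun x ↦ x ^ p) (expMeasure r) := by
  refine .of_integral_ne_zero ?_
  rw [integral_rpow_expMeasure hr hp]
  have := Gamma_pos_of_pos (show 0 < p + 1 by linarith)
  positivity

theorem integrable_sqrt_expMeasure {r : ℝ} (hr : 0 < r) :
    Integrable (fun x ↦ √x) (expMeasure r) := by
  simp only [sqrt_eq_rpow]
  exact integrable_rpow_expMeasure hr (by norm_num)

theorem integral_sqrt_expMeasure {r : ℝ} (hr : 0 < r) :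
    ∫ x, √x ∂(expMeasure r) = √(π / r) / 2 := by
  simp only [sqrt_eq_rpow (_ : ℝ)]
  rw [integral_rpow_expMeasure hr (by norm_num), Gamma_add_one (by norm_num), Gamma_one_half_eq,
    div_rpow pi_pos.le hr.le, sqrt_eq_rpow]
  ring

theorem integrable_sqrt_sq_expMeasure {r : ℝ} (hr : 0 < r) :
    Integrable (fun x ↦ √x ^ 2) (expMeasure r) := by
  have h := (integrable_rpow_expMeasure hr (p := 1) (by norm_num)).pos_part
  refine h.congr (ae_of_all _ fun x ↦ ?_)
  rcases le_total 0 x with hx | hx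
  · simp [hx]
  · simp [hx, sqrt_eq_zero_of_nonpos hx]

end Exponential

section Independence

variable {α : Type*} [MeasurableSpace α] {μ : Measure α} [IsProbabilityMeasure μ] {X Y : α → ℝ}

theorem measureReal_le_comp_eq_integral (hX : Measurable X) (hY : Measurable Y)
    (hXY : IndepFun X Y μ) {h : ℝ → ℝ} (hh : Measurable h) :
    μ.real {ω | Y ω ≤ h (X ω)} = ∫ x, (μ.map Y).real (Iic (h x)) ∂(μ.map X) := by
  have := Measure.isProbabilityMeasure_map (μ := μ) hX.aemeasurable
  have := Measure.isProbabilityMeasure_map (μ := μ) hY.aemeasurable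
  have hs : MeasurableSet {z : ℝ × ℝ | z.2 ≤ h z.1} :=
    measurableSet_le measurable_snd (hh.comp measurable_fst)
  have h1 : {ω | Y ω ≤ h (X ω)} = (fun ω ↦ (X ω, Y ω)) ⁻¹' {z : ℝ × ℝ | z.2 ≤ h z.1} := rfl
  rw [h1, ← map_measureReal_apply (hX.prodMk hY) hs,
    (indepFun_iff_map_prod_eq_prod_map_map hX.aemeasurable hY.aemeasurable).1 hXY,
    measureReal_def, Measure.prod_apply hs,
    ← integral_toReal (measurable_measure_prodMk_left hs).aemeasurable
      (ae_of_all _ fun _ ↦ measure_lt_top _ _)]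
  rfl

theorem integrable_measureReal_Iic_comp (ν ρ : Measure ℝ) [IsProbabilityMeasure ν]
    [IsProbabilityMeasure ρ] {h : ℝ → ℝ} (hh : Measurable h) :
    Integrable (fun x ↦ ρ.real (Iic (h x))) ν := by
  have hm : Monotone fun t ↦ ρ.real (Iic t) := fun s t hst ↦ measureReal_mono (Iic_subset_Iic.2 hst)
  refine .of_bound (hm.measurable.comp hh).aestronglyMeasurable 1 (ae_of_all _ fun x ↦ ?_)
  rw [norm_of_nonneg measureReal_nonneg]
  exact measureReal_le_one

variable {q : ℝ}

theorem measureReal_le_comp_le (hX : Measurable X) (hY : Measurable Y) (hXY : IndepFun X Y μ)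
    (hq : 0 < q) (hYlaw : μ.map Y = expMeasure q) {h : ℝ → ℝ} (hh : Measurable h)
    (hnn : ∀ x, 0 ≤ h x) (hint : Integrable h (μ.map X)) :
    μ.real {ω | Y ω ≤ h (X ω)} ≤ q * ∫ x, h x ∂(μ.map X) := by
  have := Measure.isProbabilityMeasure_map (μ := μ) hX.aemeasurable
  have := isProbabilityMeasure_expMeasure hq
  rw [measureReal_le_comp_eq_integral hX hY hXY hh, hYlaw, ← integral_const_mul]
  exact integral_mono (integrable_measureReal_Iic_comp _ _ hh) (hint.const_mul q)
    fun x ↦ expMeasure_real_Iic_le hq (hnn x)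

theorem le_measureReal_le_comp (hX : Measurable X) (hY : Measurable Y) (hXY : IndepFun X Y μ)
    (hq : 0 < q) (hYlaw : μ.map Y = expMeasure q) {h : ℝ → ℝ} (hh : Measurable h)
    (hint : Integrable h (μ.map X))
    (hint2 : Integrable (fun x ↦ h x ^ 2) (μ.map X)) {ε : ℝ} (hε : 0 ≤ ε) :
    q * ∫ x, h x ∂(μ.map X) - q * ε - q ^ 2 / 2 * ∫ x, h x ^ 2 ∂(μ.map X) ≤
      μ.real {ω | Y ω ≤ h (X ω) - ε} := by
  have := Measure.isProbabilityMeasure_map (μ := μ) hX.aemeasurable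
  have := isProbabilityMeasure_expMeasure hq
  have hi : Integrable (fun x ↦ q * h x - q * ε) (μ.map X) :=
    (hint.const_mul q).sub (integrable_const _)
  have hi2 : Integrable (fun x ↦ q ^ 2 / 2 * h x ^ 2) (μ.map X) := hint2.const_mul _
  have heq : q * ∫ x, h x ∂(μ.map X) - q * ε - q ^ 2 / 2 * ∫ x, h x ^ 2 ∂(μ.map X) =
      ∫ x, (q * h x - q * ε - q ^ 2 / 2 * h x ^ 2) ∂(μ.map X) := by
    rw [integral_sub hi hi2, integral_sub (hint.const_mul q) (integrable_const _),
      integral_const_mul q, integral_const_mul (q ^ 2 / 2), integral_const]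
    simp
  rw [measureReal_le_comp_eq_integral hX hY hXY (h := fun x ↦ h x - ε) (hh.sub_const ε), hYlaw,
    heq]
  refine integral_mono (hi.sub hi2) (integrable_measureReal_Iic_comp _ _ (hh.sub_const ε))
    fun x ↦ ?_
  have := le_expMeasure_real_Iic (x := h x) hq hε
  simp only
  linarith

end Independence

section OutageEvent

variable {a b c φ γ x y : ℝ}

theorem outage_min_eq (ha : 0 < a) (hb : 0 < b) (hc : 0 < c) (hγ : 0 < γ) :
    ((b * γ) / (b * γ + c * γ)) * min ((a * γ) * x) ((b * γ + c * γ) * y) =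
      min (a * b / (b + c) * γ * x) (b * γ * y) := by
  rw [mul_min_of_nonneg _ _ (by positivity)]
  congr 1 <;> field_simp

theorem outage_of_le (ha : 0 < a) (hb : 0 < b) (hc : 0 < c) (hγ : 0 < γ) (hφ : 1 < φ)
    (hx : 0 ≤ x) (hy : 0 ≤ y) (hxy : y ≤ √(φ * a / (b * c)) / √γ * √x - 1 / (c * γ)) :
    (1 + ((b * γ) / (b * γ + c * γ)) * min ((a * γ) * x) ((b * γ + c * γ) * y)) /
      (1 + (a * γ) * x / ((c * γ) * y + 1)) ≤ φ := by
  rw [outage_min_eq ha hb hc hγ, div_le_iff₀ (by positivity)]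
  set s := √(φ * a / (b * c)) / √γ * √x with hs
  have hs2 : b * c * γ * s ^ 2 = φ * a * x := by
    rw [hs, mul_pow, div_pow, sq_sqrt (by positivity), sq_sqrt hγ.le, sq_sqrt hx]
    field_simp
  have h1 : c * γ * y + 1 ≤ c * γ * s := by
    have : c * γ * y ≤ c * γ * (s - 1 / (c * γ)) := by gcongr
    have h : c * γ * (s - 1 / (c * γ)) = c * γ * s - 1 := by field_simp
    linarith
  have h2 : y ≤ s := by
    have : 0 ≤ 1 / (c * γ) := by positivity
    linarith
  have h3 : b * γ * y * (c * γ * y + 1) ≤ φ * (a * γ * x) :=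
    calc b * γ * y * (c * γ * y + 1) ≤ b * γ * s * (c * γ * s) := by gcongr
      _ = γ * (b * c * γ * s ^ 2) := by ring
      _ = φ * (a * γ * x) := by rw [hs2]; ring
  have h4 : b * γ * y ≤ φ * (a * γ * x / (c * γ * y + 1)) := by
    rw [← mul_div_assoc, le_div_iff₀ (by positivity)]
    exact h3
  have := min_le_right (a * b / (b + c) * γ * x) (b * γ * y)
  linarith

theorem outage_cases (ha : 0 < a) (hb : 0 < b) (hc : 0 < c) (hγ : 0 < γ) (hφ : 1 < φ)
    (hx : 0 ≤ x) (hy : 0 ≤ y)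
    (h : (1 + ((b * γ) / (b * γ + c * γ)) * min ((a * γ) * x) ((b * γ + c * γ) * y)) /
      (1 + (a * γ) * x / ((c * γ) * y + 1)) ≤ φ) :
    x ≤ 2 * (φ - 1) * (b + c) / (a * b) / γ ∨ y ≤ 2 * φ * (b + c) / (b * c) / γ ∨
      y ≤ (φ - 1) / b / γ + √(φ * a / (b * c)) / √γ * √x := by
  rw [outage_min_eq ha hb hc hγ, div_le_iff₀ (by positivity)] at h
  by_contra! hcon
  obtain ⟨h1, h2, h3⟩ := hcon
  rw [div_div, div_lt_iff₀ (by positivity)] at h1 h2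
  rcases min_choice (a * b / (b + c) * γ * x) (b * γ * y) with hm | hm <;> rw [hm] at h
  · have h4 : φ * (a * γ * x / (c * γ * y + 1)) ≤ a * b / (b + c) * γ * x / 2 := by
      rw [← mul_div_assoc, div_le_iff₀ (by positivity)]
      have : 2 * φ * (b + c) / b ≤ c * γ * y + 1 := by
        rw [div_le_iff₀ hb]
        nlinarith
      calc φ * (a * γ * x) = a * b / (b + c) * γ * x / 2 * (2 * φ * (b + c) / b) := by field_simp
        _ ≤ _ := by gcongr
    have h5 : φ - 1 < a * b / (b + c) * γ * x / 2 := by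
      have : a * b / (b + c) * γ * x / 2 = x * (a * b * γ) / (2 * (b + c)) := by field_simp
      rw [this, lt_div_iff₀ (by positivity)]
      linarith
    linarith
  · set s := √(φ * a / (b * c)) / √γ * √x with hs
    have hs0 : 0 ≤ s := by positivity
    have hs2 : b * c * γ * s ^ 2 = φ * a * x := by
      rw [hs, mul_pow, div_pow, sq_sqrt (by positivity), sq_sqrt hγ.le, sq_sqrt hx]
      field_simp
    have hδ : 0 ≤ (φ - 1) / b / γ := by
      have : 0 ≤ φ - 1 := by linarith
      positivity
    have h4 : b * γ * s < b * γ * y - (φ - 1) := by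
      have : b * γ * ((φ - 1) / b / γ + s) < b * γ * y := by gcongr
      have h : b * γ * ((φ - 1) / b / γ + s) = φ - 1 + b * γ * s := by field_simp
      linarith
    have h5 : c * γ * s ≤ c * γ * y + 1 := by
      have : c * γ * s ≤ c * γ * y := by gcongr; linarith
      linarith
    have h6 : φ * (a * γ * x / (c * γ * y + 1)) ≤ b * γ * s := by
      rw [← mul_div_assoc, div_le_iff₀ (by positivity)]
      calc φ * (a * γ * x) = γ * (b * c * γ * s ^ 2) := by rw [hs2]; ring
        _ = b * γ * s * (c * γ * s) := by ring
        _ ≤ _ := by gcongr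
    linarith

end OutageEvent

theorem tendsto_sqrt_mul_of_le_of_ge {P : ℝ → ℝ} {K C D : ℝ}
    (hlow : ∀ γ, 0 < γ → K / √γ - C / γ ≤ P γ) (hup : ∀ γ, 0 < γ → P γ ≤ K / √γ + D / γ) :
    Tendsto (fun γ ↦ √γ * P γ) atTop (nhds K) := by
  have hlim (E : ℝ) : Tendsto (fun γ : ℝ ↦ K + E / √γ) atTop (nhds K) := by
    simpa using (tendsto_const_nhds (x := K)).add
      (tendsto_sqrt_atTop.const_div_atTop E)
  have hmul (E γ : ℝ) (hγ : 0 < γ) : √γ * (K / √γ + E / γ) = K + E / √γ := by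
    have h : √γ * √γ = γ := mul_self_sqrt hγ.le
    have h0 : √γ ≠ 0 := (sqrt_pos.2 hγ).ne'
    nth_rewrite 3 [← h]
    field_simp
  refine tendsto_of_tendsto_of_tendsto_of_le_of_le' (hlim (-C)) (hlim D) ?_ ?_ <;>
    filter_upwards [eventually_gt_atTop 0] with γ hγ <;> rw [← hmul _ γ hγ] <;> gcongr
  · have := hlow γ hγ
    rw [neg_div]
    linarith
  · exact hup γ hγ

end Auxiliary


open MeasureTheory ProbabilityTheory Real Filter in
theorem gsop_asymptotic_diversity_order {α : Type*} [MeasurableSpace α]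
    (μ : Measure α) [IsProbabilityMeasure μ]
    (gSR gRD : α → ℝ) (hgSR : Measurable gSR) (hgRD : Measurable gRD)
    (η₁ η₂ η₃ ΩSR ΩRD : ℝ)
    (hη₁ : 0 < η₁) (hη₂ : 0 < η₂) (hη₃ : 0 < η₃)
    (hsum : η₁ + η₂ + η₃ = 1) (hΩSR : 0 < ΩSR) (hΩRD : 0 < ΩRD)
    (hSRnn : ∀ᵐ ω ∂μ, 0 ≤ gSR ω) (hRDnn : ∀ᵐ ω ∂μ, 0 ≤ gRD ω)
    (hSRexp : ∀ t : ℝ, 0 ≤ t → μ {ω | t < gSR ω} = ENNReal.ofReal (Real.exp (-t / ΩSR)))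
    (hRDexp : ∀ t : ℝ, 0 ≤ t → μ {ω | t < gRD ω} = ENNReal.ofReal (Real.exp (-t / ΩRD)))
    (hindep : IndepFun gSR gRD μ)
    (φ : ℝ) (hφ : 1 < φ) :
    Tendsto
      (fun γP : ℝ => Real.sqrt γP *
        (μ {ω |
          (1 + ((η₂ * γP) / (η₂ * γP + η₃ * γP)) *
              min ((η₁ * γP) * gSR ω) ((η₂ * γP + η₃ * γP) * gRD ω)) /
            (1 + (η₁ * γP) * gSR ω / ((η₃ * γP) * gRD ω + 1)) ≤ φ}).toReal)
      atTop
      (nhds (Real.sqrt (π * η₁ * φ * ΩSR / (4 * η₂ * η₃ * ΩRD ^ 2)))) := by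
  have hr : 0 < 1 / ΩSR := by positivity
  have hq : 0 < 1 / ΩRD := by positivity
  have hX := map_eq_expMeasure hgSR hΩSR hSRnn hSRexp
  have hY := map_eq_expMeasure hgRD hΩRD hRDnn hRDexp
  set A := √(φ * η₁ / (η₂ * η₃)) with hA
  set M := ∫ x, √x ∂(μ.map gSR) with hM
  set V := ∫ x, √x ^ 2 ∂(μ.map gSR) with hV
  have hsqrt : Integrable (fun x ↦ √x) (μ.map gSR) := hX ▸ integrable_sqrt_expMeasure hr
  have hsqrt2 : Integrable (fun x ↦ √x ^ 2) (μ.map gSR) := hX ▸ integrable_sqrt_sq_expMeasure hr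
  have hlimit : √(π * η₁ * φ * ΩSR / (4 * η₂ * η₃ * ΩRD ^ 2)) = 1 / ΩRD * (A * M) := by
    have hM' : M = √(π / (1 / ΩSR)) / 2 := by rw [hM, hX, integral_sqrt_expMeasure hr]
    rw [hM', hA, sqrt_eq_iff_mul_self_eq_of_pos (by positivity)]
    have h1 := mul_self_sqrt (show 0 ≤ φ * η₁ / (η₂ * η₃) by positivity)
    have h2 := mul_self_sqrt (show 0 ≤ π / (1 / ΩSR) by positivity)
    calc _ = (1 / ΩRD) ^ 2 / 4 * (√(φ * η₁ / (η₂ * η₃)) * √(φ * η₁ / (η₂ * η₃))) *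
          (√(π / (1 / ΩSR)) * √(π / (1 / ΩSR))) := by ring
      _ = _ := by rw [h1, h2]; field_simp
  have hscaled (γ : ℝ) : ∫ x, A / √γ * √x ∂(μ.map gSR) = A / √γ * M := integral_const_mul _ _
  have hprob := Measure.isProbabilityMeasure_map (μ := μ) hgSR.aemeasurable
  rw [hlimit]
  set C₁ := 2 * (φ - 1) * (η₂ + η₃) / (η₁ * η₂) with hC₁
  set C₂ := 2 * φ * (η₂ + η₃) / (η₂ * η₃) with hC₂
  have hφ' : 0 < φ - 1 := by linarith
  refine tendsto_sqrt_mul_of_le_of_ge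
    (C := 1 / ΩRD * (1 / η₃) + (1 / ΩRD) ^ 2 / 2 * (A ^ 2 * V))
    (D := 1 / ΩSR * C₁ + 1 / ΩRD * C₂ + 1 / ΩRD * ((φ - 1) / η₂)) (fun γ hγ ↦ ?_) fun γ hγ ↦ ?_
  · have hsq : ∫ x, (A / √γ * √x) ^ 2 ∂(μ.map gSR) = A ^ 2 / γ * V := by
      simp only [mul_pow, div_pow, sq_sqrt hγ.le]
      exact integral_const_mul _ _
    have hint2 : Integrable (fun x ↦ (A / √γ * √x) ^ 2) (μ.map gSR) := by
      simp only [mul_pow]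
      exact hsqrt2.const_mul _
    have hle := le_measureReal_le_comp (h := fun x ↦ A / √γ * √x) hgSR hgRD hindep hq hY
      (by fun_prop) (hsqrt.const_mul _) hint2 (show 0 ≤ 1 / (η₃ * γ) by positivity)
    rw [hsq, hscaled] at hle
    refine (le_of_eq ?_).trans (hle.trans ?_)
    · field_simp
      ring
    · refine ENNReal.toReal_mono (measure_ne_top _ _) (measure_mono_ae ?_)
      filter_upwards [hSRnn, hRDnn] with ω hx hy h
      exact outage_of_le hη₁ hη₂ hη₃ hγ hφ hx hy h
  · have hint : Integrable (fun x ↦ (φ - 1) / η₂ / γ + A / √γ * √x) (μ.map gSR) :=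
      (integrable_const _).add (hsqrt.const_mul _)
    have h₃ := measureReal_le_comp_le (h := fun x ↦ (φ - 1) / η₂ / γ + A / √γ * √x)
      hgSR hgRD hindep hq hY (by fun_prop) (fun x ↦ by positivity) hint
    rw [integral_add (integrable_const _) (hsqrt.const_mul _), hscaled] at h₃
    simp only [integral_const, probReal_univ, one_smul] at h₃
    have h₁ : μ.real {ω | gSR ω ≤ C₁ / γ} ≤ 1 / ΩSR * (C₁ / γ) := by
      have h := map_measureReal_apply (μ := μ) hgSR (measurableSet_Iic (a := C₁ / γ))
      rw [hX] at h
      exact h.symm.le.trans (expMeasure_real_Iic_le hr (by positivity))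
    have h₂ : μ.real {ω | gRD ω ≤ C₂ / γ} ≤ 1 / ΩRD * (C₂ / γ) := by
      have h := map_measureReal_apply (μ := μ) hgRD (measurableSet_Iic (a := C₂ / γ))
      rw [hY] at h
      exact h.symm.le.trans (expMeasure_real_Iic_le hq (by positivity))
    have hunion := (measureReal_union_le (μ := μ) {ω | gSR ω ≤ C₁ / γ}
      ({ω | gRD ω ≤ C₂ / γ} ∪ {ω | gRD ω ≤ (φ - 1) / η₂ / γ + A / √γ * √(gSR ω)})).trans
      (add_le_add_right (measureReal_union_le _ _) _)
    refine (ENNReal.toReal_mono (measure_ne_top _ _) (measure_mono_ae ?_)).trans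
      (hunion.trans ((add_le_add h₁ (add_le_add h₂ h₃)).trans (le_of_eq ?_)))
    · filter_upwards [hSRnn, hRDnn] with ω hx hy h
      exact outage_cases hη₁ hη₂ hη₃ hγ hφ hx hy h
    · ring
end
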